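/- arXiv:2402.14332 — 4 statements merged into one kernel-verified Lean document; each statement's English description precedes it below -/
import Mathlib

section
/- Let G = (V,E,w) be a weighted graph on n vertices with total edge weight W, and let S_t be a random subset of V in which each vertex is included independently with probability t/n (for 0 < t ≤ n). Then |(1/t²)·E_{S_t}[SDP(G[S_t])] − (1/n²)·SDP(G)| ≤ ((n−t)/(n²t))·(SDP(G) − W/2). -/
open scoped Classical
open Real Matrix

noncomputable section

/-- The Laplacian `L = D − A` of a weighted graph given by its weight matrix. -/
def lap {V : Type*} [Fintype V] (w : Matrix V V ℝ) : Matrix V V ℝ :=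
  Matrix.of fun i j => if i = j then ∑ k, w i k else -(w i j)

/-- The optimal value of the Goemans–Williamson SDP relaxation of max-cut:
`max (1/4)·Tr(L_G X)` over PSD matrices `X` with unit diagonal. -/
def sdpVal {V : Type*} [Fintype V] (w : Matrix V V ℝ) : ℝ :=
  sSup { v : ℝ | ∃ X : Matrix V V ℝ, X.PosSemidef ∧ (∀ i, X i i = 1) ∧
    v = (1 / 4) * (lap w * X).trace }

/-- The weight matrix of the vertex-induced subgraph `G[S]`. -/
def subw {n : ℕ} (w : Matrix (Fin n) (Fin n) ℝ) (S : Finset (Fin n)) :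
    Matrix {i // i ∈ S} {i // i ∈ S} ℝ :=
  Matrix.of fun i j => w i j

/-- The total edge weight `W = Σ_{(i,j)∈E} w_ij` (each undirected edge counted once). -/
def totalW {n : ℕ} (w : Matrix (Fin n) (Fin n) ℝ) : ℝ := (1 / 2) * ∑ i, ∑ j, w i j

/-- `E_{S_t}[SDP(G[S_t])]` where each vertex of `G` is kept independently with probability
`p`. -/
def esdp {n : ℕ} (w : Matrix (Fin n) (Fin n) ℝ) (p : ℝ) : ℝ :=
  ∑ S : Finset (Fin n), p ^ S.card * (1 - p) ^ (n - S.card) * sdpVal (subw w S)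

/-- `G = (V,E,w)` is a weighted graph: symmetric nonnegative weights and no self-loops. -/
def IsWeightedGraph {n : ℕ} (w : Matrix (Fin n) (Fin n) ℝ) : Prop :=
  (∀ i j, w i j = w j i) ∧ (∀ i j, 0 ≤ w i j) ∧ (∀ i, w i i = 0)

/-- The feasible set of the Goemans–Williamson SDP: PSD matrices with unit diagonal. -/
def GWFeasible {V : Type*} (X : Matrix V V ℝ) : Prop :=
  X.PosSemidef ∧ ∀ i, X i i = 1

/-- The Goemans–Williamson objective `(1/4)·Σ_{i,j} w_ij (1 − X_ij)`. -/
def gwObj {V : Type*} [Fintype V] (w X : Matrix V V ℝ) : ℝ :=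
  (1 / 4) * ∑ i, ∑ j, w i j * (1 - X j i)

lemma gwFeasible_one {V : Type*} : GWFeasible (1 : Matrix V V ℝ) :=
  ⟨Matrix.PosSemidef.one, fun _ => Matrix.one_apply_eq _⟩

section SDP

variable {V : Type*} [Fintype V] {w X : Matrix V V ℝ}

lemma quarter_trace_lap_mul (hw : ∀ i, w i i = 0) (hX : ∀ i, X i i = 1) :
    (1 / 4) * (lap w * X).trace = gwObj w X := by
  have hlap : lap w = Matrix.diagonal (fun i => ∑ k, w i k) - w := by
    ext i j
    by_cases h : i = j
    · subst h
      simp [lap, hw]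
    · simp [lap, h]
  rw [hlap, gwObj, sub_mul, Matrix.trace_sub]
  simp [Matrix.trace, Matrix.mul_apply, Matrix.diagonal_apply, hX, mul_sub,
    Finset.sum_sub_distrib]

lemma GWFeasible.neg_one_le (hX : GWFeasible X) (i j : V) : -1 ≤ X i j := by
  have h := hX.1.dotProduct_mulVec_nonneg (Pi.single i 1 + Pi.single j 1)
  have hs : X j i = X i j := by simpa using hX.1.isHermitian.apply i j
  simp [Matrix.mulVec_add, hX.2, hs, add_dotProduct] at h
  linarith

lemma gwObj_le (hw : ∀ i j, 0 ≤ w i j) (hX : GWFeasible X) :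
    gwObj w X ≤ (1 / 4) * ∑ i, ∑ j, w i j * 2 := by
  unfold gwObj
  gcongr with i _ j _
  · exact hw i j
  · linarith [hX.neg_one_le j i]

lemma sdpVal_eq_sSup (hd : ∀ i, w i i = 0) :
    sdpVal w = sSup (gwObj w '' {X | GWFeasible X}) := by
  unfold sdpVal
  congr 1
  ext v
  constructor
  · rintro ⟨X, hX, h1, rfl⟩
    exact ⟨X, ⟨hX, h1⟩, (quarter_trace_lap_mul hd h1).symm⟩
  · rintro ⟨X, ⟨hX, h1⟩, rfl⟩
    exact ⟨X, hX, h1, (quarter_trace_lap_mul hd h1).symm⟩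

lemma gwObj_le_sdpVal (hd : ∀ i, w i i = 0) (hw : ∀ i j, 0 ≤ w i j) (hX : GWFeasible X) :
    gwObj w X ≤ sdpVal w := by
  rw [sdpVal_eq_sSup hd]
  refine le_csSup ⟨(1 / 4) * ∑ i, ∑ j, w i j * 2, ?_⟩ ⟨X, hX, rfl⟩
  rintro _ ⟨Y, hY, rfl⟩
  exact gwObj_le hw hY

lemma sdpVal_le (hd : ∀ i, w i i = 0) {b : ℝ} (h : ∀ X, GWFeasible X → gwObj w X ≤ b) :
    sdpVal w ≤ b := by
  rw [sdpVal_eq_sSup hd]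
  refine csSup_le (Set.Nonempty.image _ ⟨1, gwFeasible_one⟩) ?_
  rintro _ ⟨Y, hY, rfl⟩
  exact h Y hY

lemma exists_lt_gwObj (hd : ∀ i, w i i = 0) {ε : ℝ} (hε : 0 < ε) :
    ∃ X, GWFeasible X ∧ sdpVal w - ε < gwObj w X := by
  by_contra! h
  linarith [sdpVal_le hd h]

end SDP

section Sampling

variable {n : ℕ}

/-- The probability of drawing `S` when each vertex is kept independently with
probability `p`. -/
def sampleProb (p : ℝ) (S : Finset (Fin n)) : ℝ :=
  p ^ S.card * (1 - p) ^ (n - S.card)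

lemma sampleProb_nonneg {p : ℝ} (h0 : 0 ≤ p) (h1 : p ≤ 1) (S : Finset (Fin n)) :
    0 ≤ sampleProb p S :=
  mul_nonneg (pow_nonneg h0 _) (pow_nonneg (sub_nonneg.2 h1) _)

lemma sum_sampleProb_superset (p : ℝ) (T : Finset (Fin n)) :
    ∑ S, sampleProb p S * (if T ⊆ S then 1 else 0) = p ^ T.card := by
  have h := Finset.prod_add (fun _ : Fin n => p) (fun i => if i ∈ T then 0 else 1 - p)
    Finset.univ
  have hl : ∏ i : Fin n, (p + if i ∈ T then 0 else 1 - p) = p ^ T.card := by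
    rw [← Finset.prod_const, ← Finset.prod_subset (Finset.subset_univ T)]
    · exact Finset.prod_congr rfl fun i hi => by simp [hi]
    · intro i _ hi
      simp [hi]
  rw [hl, Finset.powerset_univ] at h
  rw [h]
  refine Finset.sum_congr rfl fun S _ => ?_
  rw [Finset.prod_const, sampleProb, mul_assoc]
  congr 1
  by_cases hT : T ⊆ S
  · rw [if_pos hT, mul_one]
    have hc : (Finset.univ \ S).card = n - S.card := by
      rw [Finset.card_sdiff_of_subset (Finset.subset_univ S), Finset.card_univ,
        Fintype.card_fin]
    rw [← hc, ← Finset.prod_const]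
    refine Finset.prod_congr rfl fun i hi => ?_
    rw [if_neg fun hiT => (Finset.mem_sdiff.1 hi).2 (hT hiT)]
  · obtain ⟨i, hiT, hiS⟩ := Finset.not_subset.1 hT
    rw [if_neg hT, mul_zero]
    exact (Finset.prod_eq_zero (i := i) (by simp [hiS]) (by simp [hiT])).symm

lemma sum_sampleProb (p : ℝ) : ∑ S : Finset (Fin n), sampleProb p S = 1 := by
  simpa using sum_sampleProb_superset p (∅ : Finset (Fin n))

lemma sum_sampleProb_mem (p : ℝ) (i : Fin n) :
    ∑ S : Finset (Fin n), sampleProb p S * (if i ∈ S then 1 else 0) = p := by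
  simpa using sum_sampleProb_superset p {i}

lemma sum_sampleProb_pair (p : ℝ) {i j : Fin n} (hij : i ≠ j) :
    ∑ S : Finset (Fin n), sampleProb p S * (if i ∈ S ∧ j ∈ S then 1 else 0) = p ^ 2 := by
  simpa [Finset.insert_subset_iff, Finset.card_pair hij]
    using sum_sampleProb_superset p {i, j}

lemma sum_subtype_pair (S : Finset (Fin n)) (g : Fin n → Fin n → ℝ) :
    ∑ i : {i // i ∈ S}, ∑ j : {i // i ∈ S}, g i j =
      ∑ i, ∑ j, g i j * (if i ∈ S ∧ j ∈ S then 1 else 0) := by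
  have hrow : ∀ f : Fin n → ℝ, ∑ i : {i // i ∈ S}, f i = ∑ i, if i ∈ S then f i else 0 := by
    intro f
    rw [Finset.sum_coe_sort S f]
    simp
  rw [hrow fun i => ∑ j : {i // i ∈ S}, g i j]
  refine Finset.sum_congr rfl fun i _ => ?_
  rw [hrow]
  by_cases hi : i ∈ S <;> simp [hi]

/-- The expected total weight on kept pairs is `p²` times the full total, off the diagonal. -/
lemma sum_sampleProb_mul_sum_subtype (p : ℝ) {g : Fin n → Fin n → ℝ} (hg : ∀ i, g i i = 0) :
    ∑ S : Finset (Fin n), sampleProb p S *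
        ∑ i : {i // i ∈ S}, ∑ j : {i // i ∈ S}, g i j =
      p ^ 2 * ∑ i, ∑ j, g i j := by
  simp_rw [sum_subtype_pair, Finset.mul_sum]
  rw [Finset.sum_comm]
  refine Finset.sum_congr rfl fun i _ => ?_
  rw [Finset.sum_comm]
  refine Finset.sum_congr rfl fun j _ => ?_
  by_cases hij : i = j
  · subst hij
    simp [hg]
  · rw [← sum_sampleProb_pair p hij, Finset.sum_mul]
    exact Finset.sum_congr rfl fun S _ => by ring

/-- Extension by zero of a matrix indexed by `S`. -/
def zeroExtend (S : Finset (Fin n)) (X : Matrix {i // i ∈ S} {i // i ∈ S} ℝ) :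
    Matrix (Fin n) (Fin n) ℝ :=
  Matrix.of fun i j => if h : i ∈ S ∧ j ∈ S then X ⟨i, h.1⟩ ⟨j, h.2⟩ else 0

lemma zeroExtend_posSemidef {S : Finset (Fin n)} {X : Matrix {i // i ∈ S} {i // i ∈ S} ℝ}
    (hX : X.PosSemidef) : (zeroExtend S X).PosSemidef := by
  have h := hX.mul_mul_conjTranspose_same
    (Matrix.of fun (i : Fin n) (j : {i // i ∈ S}) => if i = j then (1 : ℝ) else 0)
  convert h using 1
  have key : ∀ (i : Fin n) (f : {i // i ∈ S} → ℝ),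
      (∑ x : {i // i ∈ S}, if i = x then f x else 0) = if h : i ∈ S then f ⟨i, h⟩ else 0 := by
    intro i f
    split_ifs with hi
    · rw [Finset.sum_eq_single ⟨i, hi⟩]
      · simp
      · intro b _ hb
        rw [if_neg]
        rintro rfl
        exact hb rfl
      · simp
    · refine Finset.sum_eq_zero fun x _ => if_neg ?_
      rintro rfl
      exact hi x.2
  ext i j
  simp only [zeroExtend, Matrix.of_apply, Matrix.mul_apply, Matrix.conjTranspose_apply,
    ite_mul, one_mul, zero_mul, key, apply_ite star, star_one, star_zero, mul_ite, mul_one,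
    mul_zero]
  by_cases hi : i ∈ S <;> by_cases hj : j ∈ S <;> simp [hi, hj]

lemma zeroExtend_diag {S : Finset (Fin n)} {X : Matrix {i // i ∈ S} {i // i ∈ S} ℝ}
    (hX : ∀ i, X i i = 1) (i : Fin n) :
    zeroExtend S X i i = if i ∈ S then 1 else 0 := by
  by_cases hi : i ∈ S <;> simp [zeroExtend, hi, hX]

/-- Averaging zero-extended feasible matrices over the random sample and rescaling by `1/p`
gives a feasible matrix. -/
lemma gwFeasible_average {p : ℝ} (h0 : 0 < p) (h1 : p ≤ 1)
    {X : ∀ S : Finset (Fin n), Matrix {i // i ∈ S} {i // i ∈ S} ℝ}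
    (hX : ∀ S, GWFeasible (X S)) :
    GWFeasible (p⁻¹ • ∑ S, sampleProb p S • zeroExtend S (X S)) := by
  constructor
  · refine Matrix.PosSemidef.smul (Matrix.posSemidef_sum _ fun S _ => ?_) (inv_nonneg.2 h0.le)
    exact (zeroExtend_posSemidef (hX S).1).smul (sampleProb_nonneg h0.le h1 S)
  · intro i
    simp only [Matrix.smul_apply, Matrix.sum_apply, zeroExtend_diag (hX _).2, smul_eq_mul]
    rw [sum_sampleProb_mem, inv_mul_cancel₀ h0.ne']

end Sampling

section Bounds

variable {n : ℕ} {w : Matrix (Fin n) (Fin n) ℝ}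

lemma esdp_eq (p : ℝ) : esdp w p = ∑ S, sampleProb p S * sdpVal (subw w S) := rfl

lemma gwObj_eq (X : Matrix (Fin n) (Fin n) ℝ) :
    gwObj w X = totalW w / 2 - (1 / 4) * ∑ i, ∑ j, w i j * X j i := by
  simp only [gwObj, totalW, mul_sub, mul_one, Finset.sum_sub_distrib]
  ring

lemma half_totalW_le_sdpVal (hw : IsWeightedGraph w) : totalW w / 2 ≤ sdpVal w := by
  have h := gwObj_le_sdpVal hw.2.2 hw.2.1 gwFeasible_one
  rw [gwObj_eq] at h
  simpa [Matrix.one_apply, hw.2.2] using h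

lemma sq_mul_sdpVal_le_esdp (hw : IsWeightedGraph w) {p : ℝ} (h0 : 0 < p) (h1 : p ≤ 1) :
    p ^ 2 * sdpVal w ≤ esdp w p := by
  have hp : 0 < p ^ 2 := pow_pos h0 2
  rw [mul_comm, ← le_div_iff₀ hp]
  refine sdpVal_le hw.2.2 fun X hX => ?_
  rw [le_div_iff₀ hp, mul_comm, esdp_eq]
  have hsum := sum_sampleProb_mul_sum_subtype p (g := fun i j => w i j * (1 - X j i))
    (fun i => by simp [hw.2.2])
  calc p ^ 2 * gwObj w X
      = (1 / 4) * (p ^ 2 * ∑ i, ∑ j, w i j * (1 - X j i)) := by rw [gwObj]; ring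
    _ = ∑ S, sampleProb p S * gwObj (subw w S) (X.submatrix (↑) (↑)) := by
        rw [← hsum, Finset.mul_sum]
        refine Finset.sum_congr rfl fun S _ => ?_
        simp only [gwObj, subw, Matrix.of_apply, Matrix.submatrix_apply]
        ring
    _ ≤ ∑ S, sampleProb p S * sdpVal (subw w S) := by
        refine Finset.sum_le_sum fun S _ =>
          mul_le_mul_of_nonneg_left ?_ (sampleProb_nonneg h0.le h1 S)
        exact gwObj_le_sdpVal (fun i => hw.2.2 i) (fun i j => hw.2.1 i j)
          ⟨hX.1.submatrix _, fun i => hX.2 i⟩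

lemma sum_subw_mul (S : Finset (Fin n)) (X : Matrix {i // i ∈ S} {i // i ∈ S} ℝ) :
    ∑ i, ∑ j, subw w S i j * X j i = ∑ i, ∑ j, w i j * zeroExtend S X j i := by
  have h := sum_subtype_pair S (fun i j => w i j * zeroExtend S X j i)
  rw [show ∑ i, ∑ j, subw w S i j * X j i =
      ∑ i : {i // i ∈ S}, ∑ j : {i // i ∈ S}, w i j * zeroExtend S X j i by
    simp [subw, zeroExtend], h]
  refine Finset.sum_congr rfl fun i _ => Finset.sum_congr rfl fun j _ => ?_
  by_cases hi : i ∈ S <;> by_cases hj : j ∈ S <;> simp [zeroExtend, hi, hj]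

lemma esdp_le (hw : IsWeightedGraph w) {p : ℝ} (h0 : 0 < p) (h1 : p ≤ 1) :
    esdp w p ≤ p ^ 2 * (totalW w / 2) + p * (sdpVal w - totalW w / 2) := by
  refine le_of_forall_pos_le_add fun ε hε => ?_
  choose X hX hlt using fun S : Finset (Fin n) =>
    exists_lt_gwObj (w := subw w S) (fun i => hw.2.2 i) hε
  have hobj : ∀ S, gwObj (subw w S) (X S) =
      (1 / 4) * ∑ i : {i // i ∈ S}, ∑ j : {i // i ∈ S}, w i j -
        (1 / 4) * ∑ i, ∑ j, w i j * zeroExtend S (X S) j i := by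
    intro S
    rw [← sum_subw_mul]
    simp only [gwObj, subw, Matrix.of_apply, mul_sub, mul_one, Finset.sum_sub_distrib]
  have havg := gwObj_le_sdpVal hw.2.2 hw.2.1 (gwFeasible_average h0 h1 hX)
  have hlin : ∑ i, ∑ j, w i j * (p⁻¹ • ∑ S, sampleProb p S • zeroExtend S (X S)) j i =
      p⁻¹ * ∑ S, sampleProb p S * ∑ i, ∑ j, w i j * zeroExtend S (X S) j i := by
    simp only [Matrix.smul_apply, Matrix.sum_apply, smul_eq_mul, Finset.mul_sum]
    rw [Finset.sum_comm (s := (Finset.univ : Finset (Finset (Fin n))))]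
    refine Finset.sum_congr rfl fun i _ => ?_
    rw [Finset.sum_comm (s := (Finset.univ : Finset (Finset (Fin n))))]
    refine Finset.sum_congr rfl fun j _ => Finset.sum_congr rfl fun S _ => by ring
  rw [gwObj_eq, hlin] at havg
  have hW := sum_sampleProb_mul_sum_subtype p (g := fun i j => w i j) hw.2.2
  set A := ∑ S, sampleProb p S * ∑ i, ∑ j, w i j * zeroExtend S (X S) j i
  have havg' : -(1 / 4) * A ≤ p * (sdpVal w - totalW w / 2) := by
    have h := mul_le_mul_of_nonneg_left havg h0.le
    have hA : p * (p⁻¹ * A) = A := mul_inv_cancel_left₀ h0.ne' A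
    linarith
  have hE : esdp w p ≤ ∑ S, sampleProb p S * (gwObj (subw w S) (X S) + ε) := by
    rw [esdp_eq]
    refine Finset.sum_le_sum fun S _ =>
      mul_le_mul_of_nonneg_left ?_ (sampleProb_nonneg h0.le h1 S)
    linarith [hlt S]
  have hS : ∑ S, sampleProb p S * (gwObj (subw w S) (X S) + ε) =
      p ^ 2 * (totalW w / 2) - (1 / 4) * A + ε := by
    have hterm : ∀ S, sampleProb p S * (gwObj (subw w S) (X S) + ε) =
        (1 / 4) * (sampleProb p S * ∑ i : {i // i ∈ S}, ∑ j : {i // i ∈ S}, w i j) -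
        (1 / 4) * (sampleProb p S * ∑ i, ∑ j, w i j * zeroExtend S (X S) j i) +
        sampleProb p S * ε := fun S => by rw [hobj S]; ring
    simp_rw [hterm]
    rw [Finset.sum_add_distrib, Finset.sum_sub_distrib, ← Finset.mul_sum, ← Finset.mul_sum,
      ← Finset.sum_mul, sum_sampleProb, hW, totalW]
    ring
  linarith

end Bounds

/-- For a weighted graph `G` on `n` vertices with total edge weight `W` and a
random subset `S_t` keeping each vertex independently with probability `t/n` (`0 < t ≤ n`),
`|(1/t²)·E[SDP(G[S_t])] − (1/n²)·SDP(G)| ≤ ((n−t)/(n²t))·(SDP(G) − W/2)`. -/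
theorem stmt11 {n : ℕ} (hn : 0 < n) (w : Matrix (Fin n) (Fin n) ℝ)
    (hw : IsWeightedGraph w) (t : ℝ) (ht : 0 < t) (htn : t ≤ n) :
    |(1 / t ^ 2) * esdp w (t / n) - (1 / (n : ℝ) ^ 2) * sdpVal w| ≤
      (((n : ℝ) - t) / ((n : ℝ) ^ 2 * t)) * (sdpVal w - totalW w / 2) := by
  have hn' : (0 : ℝ) < n := Nat.cast_pos.2 hn
  have h0 : 0 < t / n := div_pos ht hn'
  have h1 : t / n ≤ 1 := (div_le_one hn').2 htn
  have hlow := sq_mul_sdpVal_le_esdp hw h0 h1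
  have hup := esdp_le hw h0 h1
  have hW := half_totalW_le_sdpVal hw
  have ht2 : 0 ≤ 1 / t ^ 2 := by positivity
  have hlow' := mul_le_mul_of_nonneg_left hlow ht2
  have hup' := mul_le_mul_of_nonneg_left hup ht2
  have e1 : 1 / t ^ 2 * ((t / n) ^ 2 * sdpVal w) = 1 / (n : ℝ) ^ 2 * sdpVal w := by
    field_simp
  have e2 : 1 / t ^ 2 * ((t / n) ^ 2 * (totalW w / 2) + t / n * (sdpVal w - totalW w / 2)) =
      1 / (n : ℝ) ^ 2 * sdpVal w +
        ((n : ℝ) - t) / ((n : ℝ) ^ 2 * t) * (sdpVal w - totalW w / 2) := by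
    field_simp
    ring
  have hR : 0 ≤ ((n : ℝ) - t) / ((n : ℝ) ^ 2 * t) * (sdpVal w - totalW w / 2) :=
    mul_nonneg (div_nonneg (sub_nonneg.2 htn) (by positivity)) (sub_nonneg.2 hW)
  rw [abs_le]
  constructor <;> linarith
end
end

section
/- Let G = (V,E,w) be a weighted graph on n vertices, and let S_t be a random subset of V in which each vertex is included independently with probability t/n. Then E_{S_t}[SDP(G[S_t])] ≥ (t²/n²)·SDP(G). -/
open scoped Classical
open Real Matrix

noncomputable section

/-- The entries of a positive semidefinite matrix with unit diagonal are at least `-1`. -/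
lemma neg_one_le_of_posSemidef {V : Type*} [Fintype V] {X : Matrix V V ℝ}
    (hX : X.PosSemidef) (hd : ∀ i, X i i = 1) (i j : V) : -1 ≤ X i j := by
  have h := hX.dotProduct_mulVec_nonneg (Pi.single i 1 + Pi.single j 1)
  have hs : X j i = X i j := by simpa using hX.1.apply i j
  simp [Matrix.mulVec_add, hd, hs] at h
  linarith

/-- The max-cut SDP objective, written as a sum over ordered pairs of vertices. -/
lemma trace_lap_mul {V : Type*} [Fintype V] {w X : Matrix V V ℝ} (hw : ∀ i, w i i = 0)
    (hX : X.PosSemidef) (hd : ∀ i, X i i = 1) :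
    (lap w * X).trace = ∑ i, ∑ j, w i j * (1 - X i j) := by
  simp only [Matrix.trace, Matrix.diag, Matrix.mul_apply]
  refine Finset.sum_congr rfl fun i _ => ?_
  have h : ∀ j, lap w i j * X j i = (if i = j then ∑ k, w i k else 0) - w i j * X i j := by
    intro j
    have hs : X j i = X i j := by simpa using hX.1.apply i j
    by_cases hij : i = j
    · subst hij
      simp [lap, hd, hw]
    · simp [lap, hij, hs]
  simp only [h, Finset.sum_sub_distrib, mul_sub, mul_one]
  simp

lemma le_sdpVal {V : Type*} [Fintype V] {w X : Matrix V V ℝ} (hw : ∀ i, w i i = 0)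
    (hw0 : ∀ i j, 0 ≤ w i j) (hX : X.PosSemidef) (hd : ∀ i, X i i = 1) :
    (1 / 4) * ∑ i, ∑ j, w i j * (1 - X i j) ≤ sdpVal w := by
  refine le_csSup ⟨(1 / 4) * ∑ i, ∑ j, w i j * 2, ?_⟩
    ⟨X, hX, hd, by rw [trace_lap_mul hw hX hd]⟩
  rintro _ ⟨Y, hY, hYd, rfl⟩
  rw [trace_lap_mul hw hY hYd]
  gcongr with i _ j _
  · exact hw0 i j
  · linarith [neg_one_le_of_posSemidef hY hYd i j]

/-- A binomial random subset contains a given set `T` with probability `p ^ T.card`. -/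
lemma sum_binomial_superset {n : ℕ} (p : ℝ) (T : Finset (Fin n)) :
    ∑ S : Finset (Fin n), p ^ S.card * (1 - p) ^ (n - S.card) * (if T ⊆ S then 1 else 0)
      = p ^ T.card := by
  have h := Finset.prod_add (fun _ : Fin n => p) (fun k => if k ∈ T then 0 else 1 - p)
    Finset.univ
  have hl : ∀ k : Fin n, (p + if k ∈ T then 0 else 1 - p) = if k ∈ T then p else 1 := by
    intro k
    split_ifs <;> ring
  simp only [hl, Finset.prod_ite_mem, Finset.univ_inter, Finset.prod_const,
    Finset.powerset_univ] at h
  rw [h]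
  refine Finset.sum_congr rfl fun S _ => ?_
  rw [mul_assoc]
  congr 1
  by_cases hT : T ⊆ S
  · have hc : (Finset.univ \ S).card = n - S.card := by
      simp [Finset.card_univ_sdiff]
    rw [if_pos hT, mul_one, ← hc, ← Finset.prod_const]
    refine Finset.prod_congr rfl fun k hk => ?_
    rw [if_neg fun hkT => (Finset.mem_sdiff.1 hk).2 (hT hkT)]
  · obtain ⟨k, hkT, hkS⟩ := Finset.not_subset.1 hT
    rw [if_neg hT, mul_zero, Finset.prod_eq_zero (i := k) (by simp [hkS]) (by simp [hkT])]

/-- The expectation, over a binomial random subset, of a sum over ordered pairs of distinct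
elements of the subset. -/
lemma sum_binomial_pairs {n : ℕ} (p : ℝ) (a : Fin n → Fin n → ℝ) (ha : ∀ i, a i i = 0) :
    ∑ S : Finset (Fin n), p ^ S.card * (1 - p) ^ (n - S.card) * ∑ i ∈ S, ∑ j ∈ S, a i j
      = p ^ 2 * ∑ i, ∑ j, a i j := by
  have h : ∀ S : Finset (Fin n),
      p ^ S.card * (1 - p) ^ (n - S.card) * ∑ i ∈ S, ∑ j ∈ S, a i j
        = p ^ S.card * (1 - p) ^ (n - S.card) *
          ∑ i, ∑ j, (if {i, j} ⊆ S then 1 else 0) * a i j := by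
    intro S
    congr 1
    simp [Finset.insert_subset_iff, ite_and, Finset.sum_ite_mem]
  simp only [h, Finset.mul_sum]
  rw [Finset.sum_comm]
  refine Finset.sum_congr rfl fun i _ => ?_
  rw [Finset.sum_comm]
  refine Finset.sum_congr rfl fun j _ => ?_
  by_cases hij : i = j
  · simp [hij, ha]
  · rw [← Finset.card_pair hij, ← sum_binomial_superset p {i, j}, Finset.sum_mul]
    exact Finset.sum_congr rfl fun S _ => by ring

/-- For a weighted graph `G` on `n` vertices and a random subset `S_t` keeping
each vertex independently with probability `t/n`, `E[SDP(G[S_t])] ≥ (t²/n²)·SDP(G)`. -/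
theorem stmt13 {n : ℕ} (hn : 0 < n) (w : Matrix (Fin n) (Fin n) ℝ)
    (hw : IsWeightedGraph w) (t : ℝ) (ht : 0 < t) (htn : t ≤ n) :
    (t ^ 2 / (n : ℝ) ^ 2) * sdpVal w ≤ esdp w (t / n) := by
  obtain ⟨-, hw0, hwd⟩ := hw
  have hn' : (0 : ℝ) < n := by exact_mod_cast hn
  have hp : 0 < t / n := by positivity
  have hp1 : t / n ≤ 1 := (div_le_one hn').2 htn
  rw [← div_pow, ← le_div_iff₀' (by positivity)]
  refine csSup_le ⟨_, 1, Matrix.PosSemidef.one, fun i => Matrix.one_apply_eq i, rfl⟩ ?_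
  rintro _ ⟨X, hX, hd, rfl⟩
  rw [trace_lap_mul hwd hX hd, le_div_iff₀' (by positivity), mul_left_comm,
    ← sum_binomial_pairs (t / n) (fun i j => w i j * (1 - X i j)) (by simp [hwd]),
    Finset.mul_sum]
  refine Finset.sum_le_sum fun S _ => ?_
  rw [mul_left_comm]
  refine mul_le_mul_of_nonneg_left ?_
    (mul_nonneg (pow_nonneg hp.le _) (pow_nonneg (sub_nonneg.2 hp1) _))
  have h := le_sdpVal (w := subw w S) (fun i => hwd i) (fun i j => hw0 i j)
    (hX.submatrix Subtype.val) (fun i => hd i)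
  refine le_of_eq_of_le (congrArg _ ?_) h
  rw [← Finset.sum_coe_sort]
  refine Finset.sum_congr rfl fun i _ => ?_
  rw [← Finset.sum_coe_sort]
  rfl
end
end

section
/- Let G = (V,E,w) be a weighted graph on n vertices and S_t ⊆ V a subset of t vertices. If y* ∈ ℝ^n is an optimal solution to the dual of the Goemans–Williamson SDP for G (minimize Σ_i y_i subject to diag(y) − (1/4)L_G ⪰ 0), then the vector ȳ defined on the vertices of S_t by ȳ_i = y*_i − (1/4)·Σ_{k ∈ V∖S_t} w_ik is a feasible solution to the dual of the Goemans–Williamson SDP for the induced subgraph G[S_t], i.e., diag(ȳ) − (1/4)L_{G[S_t]} ⪰ 0. -/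
open scoped Classical
open Real Matrix

noncomputable section

/-- If `y*` is an optimal solution of the dual of the Goemans–Williamson SDP
for `G` (minimize `Σ y_i` subject to `diag(y) − (1/4)L_G ⪰ 0`), then
`ȳ_i = y*_i − (1/4)·Σ_{k∈V∖S_t} w_ik` is a feasible solution of the dual for the induced
subgraph `G[S_t]`. -/
theorem stmt14 {n : ℕ} (w : Matrix (Fin n) (Fin n) ℝ) (hw : IsWeightedGraph w)
    (S : Finset (Fin n)) (y : Fin n → ℝ)
    (hfeas : (Matrix.diagonal y - (1 / 4 : ℝ) • lap w).PosSemidef)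
    (hopt : ∀ y' : Fin n → ℝ,
      (Matrix.diagonal y' - (1 / 4 : ℝ) • lap w).PosSemidef → ∑ i, y i ≤ ∑ i, y' i) :
    (Matrix.diagonal (fun i : {i // i ∈ S} => y ↑i - (1 / 4) * ∑ k ∈ Finset.univ \ S, w ↑i k) -
      (1 / 4 : ℝ) • lap (subw w S)).PosSemidef := by
  have restrict : Matrix.diagonal
      (fun i : {i // i ∈ S} => y ↑i - (1 / 4) * ∑ k ∈ Finset.univ \ S, w ↑i k) -
      (1 / 4 : ℝ) • lap (subw w S) =
      (Matrix.diagonal y - (1 / 4 : ℝ) • lap w).submatrix Subtype.val Subtype.val := by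
    ext i j
    by_cases h : i = j
    · subst h
      have split_degree := Finset.sum_sdiff (f := fun k => w i k) (Finset.subset_univ S)
      have sum_subtype : ∑ k : {i // i ∈ S}, w i k = ∑ k ∈ S, w i k :=
        Finset.sum_coe_sort S fun k => w i k
      simp only [lap, subw, Matrix.sub_apply, Matrix.smul_apply, Matrix.diagonal_apply_eq,
        Matrix.of_apply, Matrix.submatrix_apply, if_true, smul_eq_mul]
      linarith
    · have h' : (i : Fin n) ≠ j := fun e => h (Subtype.ext e)
      simp [lap, subw, h, h']
  rw [restrict]
  exact hfeas.submatrix Subtype.val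
end
end

section
/- There exist a constant C > 0 and n₀ ∈ ℕ such that for every even n ≥ n₀ the following holds for the unweighted complete graph K_n. The matrices X_n (with 1 on the diagonal and −1/(n−1) in every off-diagonal entry) and Y_n = vv^T (where v ∈ {−1,1}^n alternates sign) are both optimal solutions of the Goemans–Williamson SDP for K_n; in particular X_n ≠ Y_n and (1/4)·Tr(L·X_n) = (1/4)·Tr(L·Y_n), where L is the Laplacian of K_n. Nevertheless the expected cut values after Goemans–Williamson hyperplane rounding differ substantially: |E[Cut(round(X_n);K_n)] − E[Cut(round(Y_n);K_n)]| = n²/4 − (n(n−1)/(2π))·arccos(−1/(n−1)) ≥ C·n. -/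
open scoped Classical
open Real Matrix

noncomputable section

/-- The expected cut value of Goemans–Williamson hyperplane rounding applied to a feasible SDP
solution `X` on the weighted graph `w`: `E[Cut(round(X);G)] = Σ_{(i,j)∈E} w_ij·arccos(X_ij)/π`
(each undirected edge counted once). -/
def ecut {V : Type*} [Fintype V] (w X : Matrix V V ℝ) : ℝ :=
  (1 / 2) * ∑ i, ∑ j, w i j * (Real.arccos (X i j) / Real.pi)

section CompleteGraph

variable {V : Type*} [Fintype V]

theorem Matrix.PosSemidef.sum_sum_nonneg {X : Matrix V V ℝ} (hX : X.PosSemidef) :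
    0 ≤ ∑ i, ∑ j, X i j := by
  simpa [dotProduct, Matrix.mulVec] using hX.dotProduct_mulVec_nonneg (fun _ => (1 : ℝ))

variable [DecidableEq V]

theorem trace_lap_complete_mul (X : Matrix V V ℝ) (hX : ∀ i, X i i = 1) :
    (lap (Matrix.of fun i j : V => if i = j then (0 : ℝ) else 1) * X).trace =
      (Fintype.card V : ℝ) ^ 2 - ∑ i, ∑ j, X i j := by
  have hdeg (i : V) : ∑ k, (if i = k then (0 : ℝ) else 1) = Fintype.card V - 1 := by
    have h (k : V) : (if i = k then (0 : ℝ) else 1) = 1 - if i = k then 1 else 0 := by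
      split_ifs <;> norm_num
    simp [h]
  have hlap (i j : V) : lap (Matrix.of fun i j : V => if i = j then (0 : ℝ) else 1) i j =
      (if i = j then (Fintype.card V : ℝ) else 0) - 1 := by
    by_cases hij : i = j <;> simp [lap, hij, hdeg]
  simp only [Matrix.trace, Matrix.diag, Matrix.mul_apply, hlap, sub_mul, one_mul,
    Finset.sum_sub_distrib, ite_mul, zero_mul, Finset.sum_ite_eq, Finset.mem_univ, if_true, hX]
  rw [Finset.sum_comm]
  simp [sq]

/-- A feasible solution whose entries sum to zero is optimal on the complete graph. -/
theorem trace_eq_sdpVal_complete {X : Matrix V V ℝ} (hX : X.PosSemidef) (hdiag : ∀ i, X i i = 1)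
    (hsum : ∑ i, ∑ j, X i j = 0) :
    (1 / 4) * (lap (Matrix.of fun i j : V => if i = j then (0 : ℝ) else 1) * X).trace =
      sdpVal (Matrix.of fun i j : V => if i = j then (0 : ℝ) else 1) := by
  symm
  refine IsGreatest.csSup_eq ⟨⟨X, hX, hdiag, rfl⟩, ?_⟩
  rintro _ ⟨Z, hZ, hZdiag, rfl⟩
  rw [trace_lap_complete_mul Z hZdiag, trace_lap_complete_mul X hdiag, hsum]
  linarith [hZ.sum_sum_nonneg]

theorem sum_ite_eq_one_else (i : V) (c : ℝ) :
    ∑ j, (if i = j then (1 : ℝ) else c) = 1 + (Fintype.card V - 1) * c := by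
  have h (j : V) : (if i = j then (1 : ℝ) else c) = c + if i = j then 1 - c else 0 := by
    split_ifs <;> ring
  simp only [h, Finset.sum_add_distrib, Finset.sum_const, Finset.sum_ite_eq, Finset.mem_univ,
    if_true, Finset.card_univ, nsmul_eq_mul]
  ring

/-- The Gram matrix of the vertices of a regular simplex is positive semidefinite. -/
theorem posSemidef_simplex (hV : 1 < Fintype.card V) :
    (Matrix.of fun i j : V => if i = j then (1 : ℝ) else
      -1 / ((Fintype.card V : ℝ) - 1)).PosSemidef := by
  have hpos : 0 < (Fintype.card V : ℝ) - 1 := by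
    have : (1 : ℝ) < Fintype.card V := by exact_mod_cast hV
    linarith
  refine .of_dotProduct_mulVec_nonneg ?_ fun x => ?_
  · ext i j
    simp [Matrix.conjTranspose_apply, eq_comm]
  · have h (i j : V) : (if i = j then (1 : ℝ) else -1 / ((Fintype.card V : ℝ) - 1)) =
        (if i = j then (Fintype.card V : ℝ) / (Fintype.card V - 1) else 0) -
          1 / ((Fintype.card V : ℝ) - 1) := by
      split_ifs <;> field_simp <;> ring
    have hquad : star x ⬝ᵥ ((Matrix.of fun i j : V => if i = j then (1 : ℝ) else
        -1 / ((Fintype.card V : ℝ) - 1)) *ᵥ x) =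
        (Fintype.card V * ∑ i, x i ^ 2 - (∑ i, x i) ^ 2) / (Fintype.card V - 1) := by
      simp only [dotProduct, Matrix.mulVec, Matrix.of_apply, h, sub_mul, Finset.sum_sub_distrib,
        ite_mul, zero_mul, Finset.sum_ite_eq, Finset.mem_univ, if_true, star_trivial,
        ← Finset.mul_sum, mul_sub, sub_div]
      rw [← Finset.sum_mul]
      congr 1
      · rw [Finset.mul_sum, Finset.sum_div]
        exact Finset.sum_congr rfl fun i _ => by ring
      · ring
    rw [hquad]
    exact div_nonneg (sub_nonneg.2 (by
      simpa using sq_sum_le_card_mul_sum_sq (s := Finset.univ) (f := x))) hpos.le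

theorem ecut_complete_const (c : ℝ) :
    ecut (Matrix.of fun i j : V => if i = j then (0 : ℝ) else 1)
      (Matrix.of fun i j : V => if i = j then (1 : ℝ) else c) =
      ((Fintype.card V : ℝ) * (Fintype.card V - 1) / (2 * π)) * arccos c := by
  have h (i j : V) : (if i = j then (0 : ℝ) else 1) *
      (arccos (if i = j then (1 : ℝ) else c) / π) =
      arccos c / π * (1 - if i = j then 1 else 0) := by
    split_ifs <;> simp
  simp only [ecut, Matrix.of_apply, h, ← Finset.mul_sum, Finset.sum_sub_distrib, Finset.sum_const,
    Finset.sum_ite_eq, Finset.mem_univ, if_true, Finset.card_univ, nsmul_eq_mul]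
  field_simp

/-- Rounding the Gram matrix of a balanced sign vector recovers a balanced cut. -/
theorem ecut_complete_balanced (v : V → ℝ) (hv : ∀ i, v i = 1 ∨ v i = -1)
    (hsum : ∑ i, v i = 0) :
    ecut (Matrix.of fun i j : V => if i = j then (0 : ℝ) else 1)
      (Matrix.of fun i j : V => v i * v j) = (Fintype.card V : ℝ) ^ 2 / 4 := by
  have h (i j : V) : (if i = j then (0 : ℝ) else 1) * (arccos (v i * v j) / π) =
      1 / 2 - 1 / 2 * (v i * v j) := by
    have hpi := pi_ne_zero
    by_cases hij : i = j
    · subst hij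
      rcases hv i with hi | hi <;> simp [hi]
    · rcases hv i with hi | hi <;> rcases hv j with hj | hj <;> simp [hi, hj, hij, hpi] <;> norm_num
  simp only [ecut, Matrix.of_apply, h, Finset.sum_sub_distrib, ← Finset.mul_sum, hsum, mul_zero,
    Finset.sum_const, Finset.card_univ, nsmul_eq_mul]
  ring

end CompleteGraph

theorem arcsin_le_mul_of_le_third {x : ℝ} (hx : 0 < x) (hx' : x ≤ 1 / 3) :
    arcsin x ≤ 6 / 5 * x := by
  have hpi := pi_gt_three
  rw [arcsin_le_iff_le_sin ⟨by linarith, by linarith⟩ ⟨by linarith, by linarith⟩]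
  have h := sin_gt_sub_cube (x := 6 / 5 * x) (by positivity)
  nlinarith [mul_nonneg hx.le (sub_nonneg.2 (mul_self_le_mul_self hx.le hx'))]

/-- The gap between the two rounded cut values is linear in the number of vertices. -/
theorem linear_le_rounding_gap {t : ℝ} (ht : 4 ≤ t) :
    1 / 20 * t ≤ t ^ 2 / 4 - (t * (t - 1) / (2 * π)) * arccos (-1 / (t - 1)) := by
  have hpi := pi_gt_three
  have hpos : 0 < t - 1 := by linarith
  have hx : 0 < 1 / (t - 1) := by positivity
  have hx' : 1 / (t - 1) ≤ 1 / 3 := one_div_le_one_div_of_le (by norm_num) (by linarith)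
  have harc := arcsin_le_mul_of_le_third hx hx'
  have hmul : (t - 1) * arcsin (1 / (t - 1)) ≤ 6 / 5 := by
    calc _ ≤ (t - 1) * (6 / 5 * (1 / (t - 1))) := by gcongr
      _ = 6 / 5 := by field_simp
  have hdiv : (t - 1) * arcsin (1 / (t - 1)) / (2 * π) ≤ 1 / 5 := by
    rw [div_le_iff₀ (by positivity)]
    linarith
  have heq : t ^ 2 / 4 - (t * (t - 1) / (2 * π)) * arccos (-1 / (t - 1)) =
      t * (1 / 4 - (t - 1) * arcsin (1 / (t - 1)) / (2 * π)) := by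
    rw [neg_div, arccos, arcsin_neg]
    field_simp
    ring
  rw [heq]
  nlinarith

/-- There are `C > 0` and `n₀` such that for every even `n ≥ n₀`, on the
unweighted complete graph `K_n`, the matrices `X_n` (unit diagonal, `−1/(n−1)` off-diagonal)
and `Y_n = vvᵀ` (`v` of alternating signs) are both optimal for the Goemans–Williamson SDP with
equal objective values, yet the expected cut values after hyperplane rounding differ:
`|E[Cut(round(Y_n))] − E[Cut(round(X_n))]| = n²/4 − (n(n−1)/(2π))·arccos(−1/(n−1)) ≥ C·n`. -/
theorem stmt17 :
    ∃ C : ℝ, 0 < C ∧ ∃ n₀ : ℕ, ∀ n : ℕ, n₀ ≤ n → Even n →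
      let w : Matrix (Fin n) (Fin n) ℝ := Matrix.of fun i j => if i = j then 0 else 1
      let Xn : Matrix (Fin n) (Fin n) ℝ :=
        Matrix.of fun i j => if i = j then 1 else -1 / ((n : ℝ) - 1)
      let Yn : Matrix (Fin n) (Fin n) ℝ :=
        Matrix.of fun i j => (-1 : ℝ) ^ (i : ℕ) * (-1 : ℝ) ^ (j : ℕ)
      (Xn.PosSemidef ∧ (∀ i, Xn i i = 1) ∧ (1 / 4) * (lap w * Xn).trace = sdpVal w) ∧
      (Yn.PosSemidef ∧ (∀ i, Yn i i = 1) ∧ (1 / 4) * (lap w * Yn).trace = sdpVal w) ∧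
      Xn ≠ Yn ∧
      (1 / 4) * (lap w * Xn).trace = (1 / 4) * (lap w * Yn).trace ∧
      |ecut w Yn - ecut w Xn| =
        (n : ℝ) ^ 2 / 4 -
          ((n : ℝ) * ((n : ℝ) - 1) / (2 * Real.pi)) * Real.arccos (-1 / ((n : ℝ) - 1)) ∧
      C * n ≤
        (n : ℝ) ^ 2 / 4 -
          ((n : ℝ) * ((n : ℝ) - 1) / (2 * Real.pi)) * Real.arccos (-1 / ((n : ℝ) - 1)) := by
  refine ⟨1 / 20, by norm_num, 4, fun n hn heven => ?_⟩
  intro w Xn Yn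
  have hn' : (4 : ℝ) ≤ n := by exact_mod_cast hn
  have hXdiag (i : Fin n) : Xn i i = 1 := by simp [Xn]
  have hYdiag (i : Fin n) : Yn i i = 1 := by simp [Yn, ← mul_pow]
  have hXpsd : Xn.PosSemidef := by
    simpa [Xn] using posSemidef_simplex (V := Fin n) (by simp; omega)
  have hYpsd : Yn.PosSemidef := by
    simpa [Matrix.vecMulVec, Yn] using
      Matrix.posSemidef_vecMulVec_self_star (fun i : Fin n => (-1 : ℝ) ^ (i : ℕ))
  have hXsum : ∑ i, ∑ j, Xn i j = 0 := by
    simp only [Xn, Matrix.of_apply, sum_ite_eq_one_else, Fintype.card_fin]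
    have : (n : ℝ) - 1 ≠ 0 := by linarith
    simp [mul_div_cancel₀ _ this]
  have hvsum : ∑ i : Fin n, (-1 : ℝ) ^ (i : ℕ) = 0 := by
    rw [Fin.sum_univ_eq_sum_range (fun i => (-1 : ℝ) ^ i), neg_one_geom_sum, if_pos heven]
  have hYsum : ∑ i, ∑ j, Yn i j = 0 := by
    simp [Yn, ← Finset.mul_sum, hvsum]
  have hXopt := trace_eq_sdpVal_complete hXpsd hXdiag hXsum
  have hYopt := trace_eq_sdpVal_complete hYpsd hYdiag hYsum
  have hgap := linear_le_rounding_gap hn'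
  refine ⟨⟨hXpsd, hXdiag, hXopt⟩, ⟨hYpsd, hYdiag, hYopt⟩, ?_, hXopt.trans hYopt.symm, ?_, hgap⟩
  · intro h
    have h02 := congrFun (congrFun h ⟨0, by omega⟩) ⟨2, by omega⟩
    have hneg : -1 / ((n : ℝ) - 1) < 0 := div_neg_of_neg_of_pos (by norm_num) (by linarith)
    simp [Xn, Yn] at h02
    linarith
  · have hX : ecut w Xn = _ := ecut_complete_const (V := Fin n) (-1 / ((n : ℝ) - 1))
    have hY : ecut w Yn = _ := ecut_complete_balanced (fun i : Fin n => (-1 : ℝ) ^ (i : ℕ))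
      (fun i => neg_one_pow_eq_or ℝ i) hvsum
    rw [hX, hY, Fintype.card_fin]
    exact abs_of_nonneg (le_trans (by positivity) hgap)
end
end
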